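/- arXiv:1502.07617 — 4 statements merged into one kernel-verified Lean document; each statement's English description precedes it below -/
import Mathlib

section
/- Let V be a finite set of K ≥ 2 actions, let η > 0, and let ℓ_1,…,ℓ_T : V → ℝ be loss functions with ℓ_t(i) ≥ 0 for all t and i. For each t define the Hedge distribution q_t on V by q_t(i) = exp(−η ∑_{s=1}^{t−1} ℓ_s(i)) / ∑_{j∈V} exp(−η ∑_{s=1}^{t−1} ℓ_s(j)). For each t let S_t ⊆ V be a subset such that ℓ_t(i) ≤ 1/η for all i ∈ S_t. Then for every i* ∈ V, ∑_{t=1}^T ∑_{i∈V} q_t(i) ℓ_t(i) − ∑_{t=1}^T ℓ_t(i*) ≤ (ln K)/η + η ∑_{t=1}^T ( ∑_{i∈S_t} q_t(i)(1−q_t(i)) ℓ_t(i)² + ∑_{i∉S_t} q_t(i) ℓ_t(i)² ). -/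
open Finset

/-- One-sided version of `Real.abs_exp_sub_one_sub_id_le`, without a lower bound on `z`. -/
theorem exp_le_one_add_add_sq {z : ℝ} (hz : z ≤ 1) : Real.exp z ≤ 1 + z + z ^ 2 := by
  rcases le_or_gt (-1) z with h | h
  · linarith [(abs_le.1 (Real.abs_exp_sub_one_sub_id_le (abs_le.2 ⟨h, hz⟩))).2]
  · have : Real.exp z ≤ 1 := Real.exp_le_one_iff.2 (by linarith)
    nlinarith

/-- Second-order bound on the log-moment generating function of `-x` under the distribution `p`,
where the coordinates in `S`, on which `x ≤ 1`, contribute only `p i * (1 - p i) * x i ^ 2`. -/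
theorem log_sum_mul_exp_neg_le {V : Type*} [Fintype V] [DecidableEq V] {p x : V → ℝ}
    (hp : ∀ i, 0 ≤ p i) (hp1 : ∑ i, p i = 1) (hx : ∀ i, 0 ≤ x i)
    (S : Finset V) (hS : ∀ i ∈ S, x i ≤ 1) :
    Real.log (∑ i, p i * Real.exp (-x i)) ≤
      -∑ i, p i * x i +
        ((∑ i ∈ S, p i * (1 - p i) * x i ^ 2) + ∑ i ∈ Sᶜ, p i * x i ^ 2) := by
  set a := ∑ i ∈ S, p i * x i with ha
  have ha0 : 0 ≤ a := sum_nonneg fun i _ => mul_nonneg (hp i) (hx i)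
  have ha1 : a ≤ 1 := calc
    a ≤ ∑ i ∈ S, p i := sum_le_sum fun i hi => mul_le_of_le_one_right (hp i) (hS i hi)
    _ ≤ ∑ i, p i := sum_le_univ_sum_of_nonneg hp
    _ = 1 := hp1
  have ham : a ≤ ∑ i, p i * x i := sum_le_univ_sum_of_nonneg fun i => mul_nonneg (hp i) (hx i)
  have hsq : ∑ i ∈ S, (p i * x i) ^ 2 ≤ a ^ 2 :=
    sum_sq_le_sq_sum_of_nonneg fun i _ => mul_nonneg (hp i) (hx i)
  have hsplit : (∑ i ∈ S, p i * (1 - p i) * x i ^ 2) + ∑ i ∈ Sᶜ, p i * x i ^ 2 =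
      ∑ i, p i * x i ^ 2 - ∑ i ∈ S, (p i * x i) ^ 2 := by
    rw [← sum_add_sum_compl S fun i => p i * x i ^ 2, add_sub_right_comm, ← sum_sub_distrib]
    congr 1
    exact sum_congr rfl fun i _ => by ring
  have hpos : 0 < ∑ i, p i * Real.exp (a - x i) := by
    obtain ⟨i, -, hi⟩ := exists_ne_zero_of_sum_ne_zero (hp1.trans_ne one_ne_zero)
    exact sum_pos' (fun i _ => mul_nonneg (hp i) (Real.exp_pos _).le)
      ⟨i, mem_univ i, mul_pos ((hp i).lt_of_ne' hi) (Real.exp_pos _)⟩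
  have hshift : ∑ i, p i * Real.exp (-x i) =
      Real.exp (-a) * ∑ i, p i * Real.exp (a - x i) := by
    rw [mul_sum]
    refine sum_congr rfl fun i _ => ?_
    rw [mul_left_comm, ← Real.exp_add]
    congr 2
    ring
  have hquad : ∑ i, p i * Real.exp (a - x i) ≤
      ∑ i, p i * (1 + (a - x i) + (a - x i) ^ 2) :=
    sum_le_sum fun i _ => mul_le_mul_of_nonneg_left
      (exp_le_one_add_add_sq (by linarith [hx i])) (hp i)
  have hexpand : ∑ i, p i * (1 + (a - x i) + (a - x i) ^ 2) =
      (1 + a + a ^ 2) * ∑ i, p i - (1 + 2 * a) * ∑ i, p i * x i + ∑ i, p i * x i ^ 2 := by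
    simp only [mul_sum]
    rw [← sum_sub_distrib, ← sum_add_distrib]
    exact sum_congr rfl fun i _ => by ring
  rw [hshift, Real.log_mul (Real.exp_pos _).ne' hpos.ne', Real.log_exp, hsplit]
  rw [hp1] at hexpand
  nlinarith [Real.log_le_sub_one_of_pos hpos]

/-- Second-order regret bound for Hedge with per-round subsets `S t` of actions
whose losses are at most `1/η`. Rounds are indexed by `t ∈ {0, …, T−1}` and
`q t` is the Hedge distribution computed from the losses of rounds `s < t`. -/
theorem hedge_second_order_refined
    {V : Type*} [Fintype V] [DecidableEq V]
    (hK : 2 ≤ Fintype.card V)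
    (T : ℕ) (η : ℝ) (hη : 0 < η)
    (ℓ : ℕ → V → ℝ) (hℓ : ∀ t, t < T → ∀ i : V, 0 ≤ ℓ t i)
    (q : ℕ → V → ℝ)
    (hq : ∀ t, ∀ i : V, q t i =
      Real.exp (-η * ∑ s ∈ Finset.range t, ℓ s i) /
        ∑ j : V, Real.exp (-η * ∑ s ∈ Finset.range t, ℓ s j))
    (S : ℕ → Finset V)
    (hS : ∀ t, t < T → ∀ i ∈ S t, ℓ t i ≤ 1 / η)
    (istar : V) :
    ∑ t ∈ Finset.range T, ∑ i : V, q t i * ℓ t i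
        - ∑ t ∈ Finset.range T, ℓ t istar ≤
      Real.log (Fintype.card V) / η +
        η * ∑ t ∈ Finset.range T,
          ((∑ i ∈ S t, q t i * (1 - q t i) * ℓ t i ^ 2) +
            ∑ i ∈ (S t)ᶜ, q t i * ℓ t i ^ 2) := by
  have : Nonempty V := ⟨istar⟩
  set W : ℕ → ℝ := fun t => ∑ j : V, Real.exp (-η * ∑ s ∈ Finset.range t, ℓ s j) with hW
  have hWpos (t : ℕ) : 0 < W t := sum_pos (fun _ _ => Real.exp_pos _) univ_nonempty
  have hq' (t : ℕ) (i : V) : q t i = Real.exp (-η * ∑ s ∈ Finset.range t, ℓ s i) / W t := hq t i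
  have hq0 (t : ℕ) (i : V) : 0 ≤ q t i := by
    rw [hq']
    exact div_nonneg (Real.exp_pos _).le (hWpos t).le
  have hq1 (t : ℕ) : ∑ i, q t i = 1 := by
    simp only [hq']
    rw [← sum_div]
    exact div_self (hWpos t).ne'
  have hstep (t : ℕ) : W (t + 1) = W t * ∑ i, q t i * Real.exp (-(η * ℓ t i)) := by
    rw [mul_sum]
    refine sum_congr rfl fun i _ => ?_
    rw [hq', ← mul_assoc, mul_div_cancel₀ _ (hWpos t).ne', ← Real.exp_add, sum_range_succ]
    congr 1
    ring
  set B : ℕ → ℝ := fun t => (∑ i ∈ S t, q t i * (1 - q t i) * ℓ t i ^ 2) +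
    ∑ i ∈ (S t)ᶜ, q t i * ℓ t i ^ 2 with hB
  have hround (t : ℕ) (ht : t < T) :
      Real.log (W (t + 1)) - Real.log (W t) ≤ -η * ∑ i, q t i * ℓ t i + η ^ 2 * B t := by
    have hne : ∑ i, q t i * Real.exp (-(η * ℓ t i)) ≠ 0 := fun h =>
      (hWpos (t + 1)).ne' (by rw [hstep, h, mul_zero])
    rw [hstep, Real.log_mul (hWpos t).ne' hne, add_sub_cancel_left]
    refine (log_sum_mul_exp_neg_le (hq0 t) (hq1 t) (fun i => mul_nonneg hη.le (hℓ t ht i)) (S t)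
      fun i hi => ?_).trans_eq ?_
    · have h := hS t ht i hi
      rwa [le_div_iff₀' hη] at h
    · simp only [hB, mul_add, mul_sum, ← sum_neg_distrib]
      congr 1
      · exact sum_congr rfl fun i _ => by ring
      · congr 1 <;> exact sum_congr rfl fun i _ => by ring
  have htotal := sum_le_sum fun t ht => hround t (mem_range.1 ht)
  rw [sum_range_sub fun t => Real.log (W t), sum_add_distrib, ← mul_sum, ← mul_sum] at htotal
  have hW0 : W 0 = Fintype.card V := by simp [hW]
  have hWT : -η * ∑ t ∈ Finset.range T, ℓ t istar ≤ Real.log (W T) := by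
    rw [Real.le_log_iff_exp_le (hWpos T)]
    exact single_le_sum (f := fun j => Real.exp (-η * ∑ s ∈ Finset.range T, ℓ s j))
      (fun _ _ => (Real.exp_pos _).le) (mem_univ istar)
  rw [hW0] at htotal
  refine le_of_mul_le_mul_left ?_ hη
  rw [mul_add, mul_div_cancel₀ _ hη.ne']
  linarith
end

section
/- Let G = (V,E) be a directed graph with |V| = K vertices (self-loops allowed), and let α be the independence number of G. Suppose each vertex i ∈ V is assigned a positive weight w_i such that ∑_{i∈V} w_i ≤ 1 and w_i ≥ ε for all i ∈ V, where 0 < ε < 1/2. Then ∑_{i∈V} w_i / (w_i + ∑_{j∈N^in(i)} w_j) ≤ 4 α ln(4K/(αε)). -/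
open Finset

/-- A set `S` of vertices is independent in the directed graph with edge
relation `E` if no edge connects two distinct vertices of `S`. -/
def IndepSet {V : Type*} (E : V → V → Prop) (S : Finset V) : Prop :=
  ∀ u ∈ S, ∀ v ∈ S, u ≠ v → ¬ E u v

/-- A weighted form of Turán's theorem (Motzkin–Straus) for the graph with reflexive closure `R`:
greedily removing the closed neighborhood of least weight yields an independent set. -/
theorem exists_pairwise_not_sq_sum_le {V : Type*} [DecidableEq V] (R : V → V → Prop)
    [DecidableRel R] (hrefl : ∀ u, R u u) (hsymm : ∀ u v, R u v → R v u)
    (w : V → ℝ) (hw : ∀ i, 0 < w i) (S : Finset V) :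
    ∃ T ⊆ S, (∀ u ∈ T, ∀ v ∈ T, u ≠ v → ¬ R u v) ∧
      (∑ i ∈ S, w i) ^ 2 ≤ (T.card : ℝ) * ∑ u ∈ S, w u * ∑ v ∈ S with R u v, w v := by
  induction S using Finset.strongInduction with
  | H S ih =>
    rcases S.eq_empty_or_nonempty with rfl | hS
    · exact ⟨∅, by simp⟩
    obtain ⟨x, hx, hmin⟩ := S.exists_min_image (fun u => ∑ v ∈ S with R u v, w v) hS
    set S' := S.filter (fun v => ¬ R x v) with hS'
    have hxS' : x ∉ S' := by simp [hS', hrefl]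
    obtain ⟨T, hTS, hT, hle⟩ := ih S' (Finset.filter_ssubset.2 ⟨x, hx, by simp [hrefl]⟩)
    have hxT : x ∉ T := fun h => hxS' (hTS h)
    refine ⟨insert x T, ?_, ?_, ?_⟩
    · exact Finset.insert_subset hx (hTS.trans (Finset.filter_subset _ _))
    · have key : ∀ v ∈ T, ¬ R x v := fun v hv => (Finset.mem_filter.1 (hTS hv)).2
      intro u hu v hv huv
      rcases Finset.mem_insert.1 hu with rfl | hu'
      · rcases Finset.mem_insert.1 hv with rfl | hv'
        · exact absurd rfl huv
        · exact key v hv'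
      · rcases Finset.mem_insert.1 hv with rfl | hv'
        · exact fun h => key u hu' (hsymm _ _ h)
        · exact hT u hu' v hv' huv
    · rw [Finset.card_insert_of_notMem hxT]
      set b := ∑ v ∈ S with R x v, w v with hb
      set a := ∑ v ∈ S', w v with ha
      set q := ∑ u ∈ S', w u * ∑ v ∈ S' with R u v, w v with hq
      have hsum : ∑ i ∈ S, w i = b + a := (Finset.sum_filter_add_sum_filter_not S _ _).symm
      have hb0 : 0 ≤ b := Finset.sum_nonneg fun i _ => (hw i).le
      have hq0 : 0 ≤ q := Finset.sum_nonneg fun i _ =>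
        mul_nonneg (hw i).le (Finset.sum_nonneg fun j _ => (hw j).le)
      have hQ : b ^ 2 + q ≤ ∑ u ∈ S, w u * ∑ v ∈ S with R u v, w v := by
        rw [← Finset.sum_filter_add_sum_filter_not S (fun v => R x v)]
        refine add_le_add ?_ ?_
        · rw [sq, hb, Finset.sum_mul]
          exact Finset.sum_le_sum fun u hu =>
            mul_le_mul_of_nonneg_left (hmin u (Finset.mem_filter.1 hu).1) (hw u).le
        · exact Finset.sum_le_sum fun u _ => mul_le_mul_of_nonneg_left
            (Finset.sum_le_sum_of_subset_of_nonneg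
              (Finset.filter_subset_filter _ (Finset.filter_subset _ _))
              fun i _ _ => (hw i).le) (hw u).le
      rw [hsum]
      have hm : (0 : ℝ) ≤ T.card := Nat.cast_nonneg _
      push_cast
      refine le_trans ?_ (mul_le_mul_of_nonneg_left hQ (by positivity))
      generalize (T.card : ℝ) = m at hm hle
      have h2 : 2 * a * b ≤ q + m * b ^ 2 := by
        rcases hm.eq_or_lt with rfl | hm
        · have : a = 0 := by nlinarith [sq_nonneg a]
          rw [this]; nlinarith
        · refine le_of_mul_le_mul_left ?_ hm
          nlinarith [sq_nonneg (a - m * b)]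
      nlinarith

/-- Every nonempty set `S` of vertices contains a vertex whose closed in-neighborhood weighs at
least `1 / (2α)` times the weight of `S`. -/
theorem exists_sum_le_two_mul_inNeighborhood {V : Type*} [Fintype V] [DecidableEq V]
    (E : V → V → Prop) [DecidableRel E] (α : ℕ)
    (hα : ∀ S : Finset V, IndepSet E S → S.card ≤ α)
    (w : V → ℝ) (hw : ∀ i, 0 < w i) (S : Finset V) (hS : S.Nonempty) :
    ∃ i ∈ S, ∑ j ∈ S, w j ≤ 2 * α * (w i + ∑ j with E j i, w j) := by
  by_contra! hcon
  obtain ⟨T, -, hT, hle⟩ := exists_pairwise_not_sq_sum_le (fun u v => u = v ∨ E u v ∨ E v u)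
    (fun u => Or.inl rfl) (fun u v h => by tauto) w hw S
  have hTα : (T.card : ℝ) ≤ α :=
    Nat.cast_le.2 (hα T fun u hu v hv huv h => hT u hu v hv huv (Or.inr (Or.inl h)))
  have hswap : ∑ u ∈ S, w u * ∑ v ∈ S with E u v, w v
      = ∑ u ∈ S, w u * ∑ v ∈ S with E v u, w v := by
    simp only [Finset.mul_sum, Finset.sum_filter]
    rw [Finset.sum_comm]
    refine Finset.sum_congr rfl fun u _ => Finset.sum_congr rfl fun v _ => ?_
    split_ifs <;> ring
  have hsplit : ∀ u ∈ S, ∑ v ∈ S with (u = v ∨ E u v ∨ E v u), w v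
      ≤ w u + ∑ v ∈ S with E u v, w v + ∑ v ∈ S with E v u, w v := by
    intro u hu
    have hself : w u = ∑ v ∈ S, if u = v then w v else 0 := by simp [hu]
    rw [hself]
    simp only [Finset.sum_filter]
    rw [← Finset.sum_add_distrib, ← Finset.sum_add_distrib]
    refine Finset.sum_le_sum fun v _ => ?_
    have := hw v
    split_ifs <;> first | linarith | tauto
  have hQ : ∑ u ∈ S, w u * ∑ v ∈ S with (u = v ∨ E u v ∨ E v u), w v
      ≤ ∑ u ∈ S, w u * (2 * (w u + ∑ v with E v u, w v)) := by
    calc _ ≤ ∑ u ∈ S, w u * (w u + ∑ v ∈ S with E u v, w v + ∑ v ∈ S with E v u, w v) :=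
          Finset.sum_le_sum fun u hu => mul_le_mul_of_nonneg_left (hsplit u hu) (hw u).le
      _ = ∑ u ∈ S, w u * (w u + 2 * ∑ v ∈ S with E v u, w v) := by
          simp only [mul_add, Finset.sum_add_distrib, two_mul, hswap]
          ring
      _ ≤ _ := by
          refine Finset.sum_le_sum fun u _ => mul_le_mul_of_nonneg_left ?_ (hw u).le
          have : ∑ v ∈ S with E v u, w v ≤ ∑ v with E v u, w v :=
            Finset.sum_le_sum_of_subset_of_nonneg
              (Finset.filter_subset_filter _ (Finset.subset_univ _)) fun i _ _ => (hw i).le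
          linarith [hw u]
  have hlt : α * ∑ u ∈ S, w u * (2 * (w u + ∑ v with E v u, w v)) < (∑ i ∈ S, w i) ^ 2 := by
    rw [sq, Finset.mul_sum, Finset.sum_mul]
    refine Finset.sum_lt_sum_of_nonempty hS fun u hu => ?_
    calc _ = w u * (2 * α * (w u + ∑ v with E v u, w v)) := by ring
      _ < _ := mul_lt_mul_of_pos_left (hcon u hu) (hw u)
  have hQ0 : 0 ≤ ∑ u ∈ S, w u * ∑ v ∈ S with (u = v ∨ E u v ∨ E v u), w v :=
    Finset.sum_nonneg fun i _ => mul_nonneg (hw i).le (Finset.sum_nonneg fun j _ => (hw j).le)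
  have h1 := mul_le_mul_of_nonneg_right hTα hQ0
  have h2 := mul_le_mul_of_nonneg_left hQ (Nat.cast_nonneg (α := ℝ) α)
  linarith

/-- If every nonempty set contains an index `i` with `D i` at least `1 / c` times the weight of
the set, then removing such indices one by one bounds `∑ wᵢ / Dᵢ` logarithmically. -/
theorem sum_div_le_one_add_mul_log {V : Type*} [DecidableEq V] (w D : V → ℝ) (c ε : ℝ)
    (hε : 0 < ε) (hc : 0 ≤ c) (hwε : ∀ i, ε ≤ w i) (hD : ∀ i, w i ≤ D i)
    (h : ∀ S : Finset V, S.Nonempty → ∃ i ∈ S, ∑ j ∈ S, w j ≤ c * D i)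
    (S : Finset V) (hS : S.Nonempty) :
    ∑ i ∈ S, w i / D i ≤ 1 + c * Real.log ((∑ i ∈ S, w i) / ε) := by
  have hw : ∀ i, 0 < w i := fun i => hε.trans_le (hwε i)
  induction S using Finset.strongInduction with
  | H S ih =>
    obtain ⟨i, hi, hle⟩ := h S hS
    have hDi : 0 < D i := (hw i).trans_le (hD i)
    have hsum : ∑ j ∈ S, w j = ∑ j ∈ S.erase i, w j + w i := (Finset.sum_erase_add S w hi).symm
    rw [← Finset.sum_erase_add S _ hi]
    rcases (S.erase i).eq_empty_or_nonempty with he | he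
    · have h1 : w i / D i ≤ 1 := (div_le_one hDi).2 (hD i)
      have h2 : 0 ≤ Real.log ((∑ j ∈ S, w j) / ε) := by
        refine Real.log_nonneg ((one_le_div hε).2 ?_)
        rw [hsum, he]
        simpa using hwε i
      rw [he, Finset.sum_empty]
      nlinarith [mul_nonneg hc h2]
    · have hrec := ih _ (Finset.erase_ssubset hi) he
      have hW' : 0 < ∑ j ∈ S.erase i, w j := Finset.sum_pos (fun j _ => hw j) he
      have hW : 0 < ∑ j ∈ S, w j := Finset.sum_pos (fun j _ => hw j) hS
      have hterm : w i / D i ≤ c * (w i / ∑ j ∈ S, w j) := by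
        rw [← mul_div_assoc, div_le_div_iff₀ hDi hW]
        nlinarith [mul_le_mul_of_nonneg_left hle (hw i).le]
      have hlog := Real.log_le_sub_one_of_pos (div_pos hW' hW)
      have hquot : (∑ j ∈ S.erase i, w j) / (∑ j ∈ S, w j) = 1 - w i / ∑ j ∈ S, w j := by
        rw [eq_sub_of_add_eq hsum.symm, sub_div, div_self hW.ne']
      rw [Real.log_div hW'.ne' hW.ne', hquot] at hlog
      rw [Real.log_div hW'.ne' hε.ne'] at hrec
      rw [Real.log_div hW.ne' hε.ne']
      have := mul_le_mul_of_nonneg_left hlog hc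
      linarith

/-- Graph-theoretic weight lemma: if every vertex has weight in `[ε, 1]` with
total weight at most `1`, then `∑ᵢ wᵢ/(wᵢ + ∑_{j ∈ N^in(i)} wⱼ)` is at most
`4 α ln(4K/(αε))`, where `α` is the independence number. -/
theorem weighted_inverse_neighborhood_bound
    {V : Type*} [Fintype V] [DecidableEq V]
    (E : V → V → Prop) [DecidableRel E]
    (α : ℕ)
    (hα₁ : ∃ S : Finset V, IndepSet E S ∧ S.card = α)
    (hα₂ : ∀ S : Finset V, IndepSet E S → S.card ≤ α)
    (w : V → ℝ) (hw : ∀ i : V, 0 < w i) (hw1 : ∑ i : V, w i ≤ 1)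
    (ε : ℝ) (hε0 : 0 < ε) (hε : ε < 1 / 2) (hwε : ∀ i : V, ε ≤ w i) :
    ∑ i : V, w i / (w i + ∑ j ∈ Finset.univ.filter (fun j => E j i), w j) ≤
      4 * (α : ℝ) * Real.log (4 * (Fintype.card V : ℝ) / ((α : ℝ) * ε)) := by
  rcases isEmpty_or_nonempty V with hV | hV
  · have : α = 0 := by
      obtain ⟨S, -, rfl⟩ := hα₁
      simp [Finset.eq_empty_of_isEmpty S]
    simp [this]
  obtain ⟨x⟩ := id hV
  have hα : (1 : ℝ) ≤ α := by
    have : IndepSet E {x} := by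
      intro u hu v hv huv
      rw [Finset.mem_singleton] at hu hv
      exact absurd (hu.trans hv.symm) huv
    exact_mod_cast hα₂ _ this
  have hαK : (α : ℝ) ≤ Fintype.card V := by
    obtain ⟨S, -, rfl⟩ := hα₁
    exact_mod_cast S.card_le_univ
  have hbound := sum_div_le_one_add_mul_log w (fun i => w i + ∑ j with E j i, w j) (2 * α) ε hε0
    (by positivity) hwε
    (fun i => le_add_of_nonneg_right (Finset.sum_nonneg fun j _ => (hw j).le))
    (exists_sum_le_two_mul_inNeighborhood E α hα₂ w hw) Finset.univ Finset.univ_nonempty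
  have hpos : 0 < ∑ i, w i := Finset.sum_pos (fun i _ => hw i) Finset.univ_nonempty
  have hlog₁ : Real.log ((∑ i, w i) / ε) ≤ Real.log (1 / ε) :=
    Real.log_le_log (by positivity) (by gcongr)
  have hlog₂ : Real.log (4 * (1 / ε)) ≤
      Real.log (4 * (Fintype.card V : ℝ) / ((α : ℝ) * ε)) := by
    refine Real.log_le_log (by positivity) ?_
    rw [← mul_div_assoc, mul_one, div_le_div_iff₀ hε0 (by positivity)]
    nlinarith [mul_le_mul_of_nonneg_right hαK hε0.le]
  have hlog₃ : 1 ≤ Real.log 4 := by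
    rw [Real.le_log_iff_exp_le (by norm_num)]
    linarith [Real.exp_one_lt_d9]
  have hlog₄ : 0 ≤ Real.log (1 / ε) :=
    Real.log_nonneg ((one_le_div hε0).2 (by linarith))
  rw [Real.log_mul (by norm_num) (by positivity)] at hlog₂
  calc _ ≤ 1 + 2 * α * Real.log ((∑ i, w i) / ε) := hbound
    _ ≤ α + 2 * α * Real.log (1 / ε) := by gcongr
    _ = α * (1 + 2 * Real.log (1 / ε)) := by ring
    _ ≤ α * (4 * Real.log (4 * (Fintype.card V : ℝ) / ((α : ℝ) * ε))) := by
        gcongr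
        linarith
    _ = _ := by ring
end

section
/- Let G = (V,E) be a directed graph on |V| = n ≥ 2 vertices (self-loops allowed), let W ⊆ V, and let k be a natural number with k > 2 ln n such that every set D ⊆ V that dominates W satisfies |D| ≥ k. Set β = (2 ln n)/k, so 0 < β < 1. Then there exists a nonempty set R ⊆ W such that every vertex v ∈ V satisfies |N^out(v) ∩ R| ≤ β·|R|. -/
open Finset

/-- A set `D` dominates a set `W` if every vertex of `W` has an incoming edge
from some vertex of `D`. -/
def Dominates {V : Type*} (E : V → V → Prop) (D W : Finset V) : Prop :=
  ∀ w ∈ W, ∃ d ∈ D, E d w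

/-- If in every nonempty `R ⊆ W` some vertex dominates at least a `β` fraction of `R`, then
picking `t` vertices greedily leaves at most `(1 - β) ^ t * |W|` vertices of `W` undominated. -/
lemma exists_greedy_cover {V : Type*} [Fintype V] [DecidableEq V]
    (E : V → V → Prop) [DecidableRel E] (W : Finset V) {β : ℝ} (hβ : β ≤ 1)
    (h : ∀ R ⊆ W, R.Nonempty →
      ∃ v : V, β * (R.card : ℝ) ≤ ((Finset.univ.filter (fun j => E v j) ∩ R).card : ℝ)) (t : ℕ) :
    ∃ D R : Finset V, R ⊆ W ∧ D.card ≤ t ∧ Dominates E D (W \ R) ∧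
      (R.card : ℝ) ≤ (1 - β) ^ t * (W.card : ℝ) := by
  induction t with
  | zero => exact ⟨∅, W, Subset.rfl, by simp, by simp [Dominates], by simp⟩
  | succ t ih =>
    obtain ⟨D, R, hRW, hD, hdom, hR⟩ := ih
    rcases R.eq_empty_or_nonempty with rfl | hne
    · refine ⟨D, ∅, hRW, hD.trans t.le_succ, hdom, ?_⟩
      have := sub_nonneg.2 hβ
      rw [card_empty, Nat.cast_zero]
      positivity
    · obtain ⟨v, hv⟩ := h R hRW hne
      refine ⟨insert v D, R \ Finset.univ.filter (fun j => E v j), sdiff_subset.trans hRW,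
        (card_insert_le _ _).trans (by lia), fun w hw => ?_, ?_⟩
      · by_cases hvw : E v w
        · exact ⟨v, mem_insert_self _ _, hvw⟩
        · obtain ⟨d, hd, hdw⟩ := hdom w (by simp_all)
          exact ⟨d, mem_insert_of_mem hd, hdw⟩
      · have hcard : ((R \ Finset.univ.filter (fun j => E v j)).card : ℝ) +
            ((Finset.univ.filter (fun j => E v j) ∩ R).card : ℝ) = R.card := by
          rw [inter_comm]
          exact_mod_cast card_sdiff_add_card_inter R _
        calc ((R \ Finset.univ.filter (fun j => E v j)).card : ℝ)
            ≤ (1 - β) * R.card := by linarith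
          _ ≤ (1 - β) * ((1 - β) ^ t * W.card) :=
              mul_le_mul_of_nonneg_left hR (sub_nonneg.2 hβ)
          _ = (1 - β) ^ (t + 1) * W.card := by ring

/-- If `k > 2 ln n` and every set dominating `W` has at least `k` vertices,
then (with `β = 2 ln n / k`, so `0 < β < 1`) `W` contains a nonempty set `R`
such that every vertex of the graph dominates at most a `β` fraction of `R`. -/
theorem exists_hard_to_cover_subset
    {V : Type*} [Fintype V] [DecidableEq V]
    (E : V → V → Prop) [DecidableRel E]
    (n : ℕ) (hn : Fintype.card V = n) (hn2 : 2 ≤ n)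
    (W : Finset V) (k : ℕ) (hkβ : 2 * Real.log n < (k : ℝ))
    (hk : ∀ D : Finset V, Dominates E D W → k ≤ D.card) :
    ∃ R : Finset V, R ⊆ W ∧ R.Nonempty ∧
      ∀ v : V,
        (((Finset.univ.filter (fun j => E v j)) ∩ R).card : ℝ) ≤
          (2 * Real.log n / (k : ℝ)) * (R.card : ℝ) := by
  have hn1 : (1 : ℝ) < n := by exact_mod_cast hn2
  have hlog : 0 < Real.log n := Real.log_pos hn1
  have hk0 : (0 : ℝ) < k := by linarith
  have hk2 : 2 ≤ k := by
    have h2 : Real.log 2 ≤ Real.log n :=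
      Real.log_le_log (by norm_num) (by exact_mod_cast hn2)
    have : (1 : ℝ) < k := by linarith [Real.log_two_gt_d9]
    exact_mod_cast this
  set β : ℝ := 2 * Real.log n / k
  have hβ0 : 0 < β := by positivity
  have hβ1 : β < 1 := (div_lt_one hk0).2 hkβ
  by_contra! hcon
  obtain ⟨D, R, hRW, hD, hdom, hR⟩ := exists_greedy_cover E W hβ1.le
    (fun R hRW hne => (hcon R hRW hne).imp fun _ hv => hv.le) (k - 1)
  have hne : R.Nonempty := by
    by_contra hempty
    rw [not_nonempty_iff_eq_empty] at hempty
    subst hempty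
    have := hk D (by simpa using hdom)
    lia
  have hR1 : (1 : ℝ) ≤ R.card := by exact_mod_cast hne.card_pos
  have hWn : (W.card : ℝ) ≤ n := by exact_mod_cast hn ▸ card_le_univ W
  have hpow : (1 - β) ^ (k - 1) < Real.exp (-β) ^ (k - 1) :=
    pow_lt_pow_left₀ (by linarith [Real.add_one_lt_exp (neg_ne_zero.2 hβ0.ne')])
      (by linarith) (by lia)
  have hexp : Real.exp (-β) ^ (k - 1) * n ≤ 1 := by
    have hexplog : (n : ℝ) = Real.exp (Real.log n) := (Real.exp_log (zero_lt_one.trans hn1)).symm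
    rw [← Real.exp_nat_mul, hexplog, ← Real.exp_add, Real.exp_le_one_iff, Nat.cast_sub (by lia), Nat.cast_one]
    have hβk : β * k = 2 * Real.log n := div_mul_cancel₀ _ hk0.ne'
    have hk2' : (2 : ℝ) ≤ k := by exact_mod_cast hk2
    nlinarith [mul_nonneg hβ0.le (sub_nonneg.2 hk2')]
  have hlt : (1 - β) ^ (k - 1) * (n : ℝ) < Real.exp (-β) ^ (k - 1) * n :=
    mul_lt_mul_of_pos_right hpow (zero_lt_one.trans hn1)
  have hle : (1 - β) ^ (k - 1) * (W.card : ℝ) ≤ (1 - β) ^ (k - 1) * n :=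
    mul_le_mul_of_nonneg_left hWn (pow_nonneg (by linarith) _)
  linarith
end

section
/- For all natural numbers r and m with 1 ≤ m and 10·m ≤ r, one has r·(1 − (1 − 1/r)^m) ≥ (9/10)·m, where the expression is interpreted over the real numbers. -/
/-- A Bernoulli-type upper bound: `(1 - x)^m ≤ 1 / (1 + m x)` in product form. -/
theorem one_sub_pow_mul_one_add_mul_le_one {x : ℝ} (hx₀ : 0 ≤ x) (hx₁ : x ≤ 1) (m : ℕ) :
    (1 - x) ^ m * (1 + m * x) ≤ 1 := by
  have hx : 0 ≤ 1 - x := sub_nonneg.2 hx₁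
  calc (1 - x) ^ m * (1 + m * x)
      ≤ (1 - x) ^ m * (1 + x) ^ m := by
        gcongr
        exact one_add_mul_le_pow (by linarith) m
    _ = ((1 - x) * (1 + x)) ^ m := (mul_pow _ _ _).symm
    _ ≤ 1 := pow_le_one₀ (by positivity) (by nlinarith)

/-- The expected number of distinct values among `m` uniform draws (with
replacement) from `r` elements, namely `r·(1 − (1 − 1/r)^m)`, is at least
`(9/10)·m` whenever `10·m ≤ r`. -/
theorem expected_distinct_draws_lower_bound
    (r m : ℕ) (hm : 1 ≤ m) (hr : 10 * m ≤ r) :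
    (9 / 10 : ℝ) * (m : ℝ) ≤ (r : ℝ) * (1 - (1 - 1 / (r : ℝ)) ^ m) := by
  have hm' : (1 : ℝ) ≤ m := by exact_mod_cast hm
  have hr' : 10 * (m : ℝ) ≤ r := by exact_mod_cast hr
  have hr₀ : (0 : ℝ) < r := by linarith
  have hbound := one_sub_pow_mul_one_add_mul_le_one (x := 1 / (r : ℝ)) (by positivity)
    ((div_le_one hr₀).2 (by linarith)) m
  have ht : (m : ℝ) * (1 / r) ≤ 1 / 10 := by
    rw [mul_one_div, div_le_iff₀ hr₀]
    linarith
  have ht₀ : 0 ≤ (m : ℝ) * (1 / r) := by positivity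
  have hrt : (r : ℝ) * (m * (1 / r)) = m := by field_simp
  generalize (m : ℝ) * (1 / r) = t at *
  have hpow : (1 - 1 / (r : ℝ)) ^ m ≤ 1 - 9 / 10 * t := by
    refine le_of_mul_le_mul_right (hbound.trans ?_) (by linarith : 0 < 1 + t)
    nlinarith
  calc (9 / 10 : ℝ) * m = r * (9 / 10 * t) := by rw [← hrt]; ring
    _ ≤ r * (1 - (1 - 1 / (r : ℝ)) ^ m) := by
        gcongr
        linarith
end
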